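/- Define, for positive reals t012, e01, e10, e12, e21, the polynomials ⊤_c = e01·e10²·e12²·e21·t012 − e12³ − 1 and ⊥_c = e21³·t012 + t012 − e01²·e10·e12·e21², and set p = (e12³ + 1)/(e01·e10²·e12²·e21) and q = (e01²·e10·e12·e21²)/(e21³ + 1). Then the set { (t012, e01, e10, e12, e21) ∈ (0,∞)⁵ : ⊤_c < 0 and ⊥_c < 0 } equals { (t012, e01, e10, e12, e21) ∈ (0,∞)⁵ : t012 < min(p, q) }, and this set, with its subspace topology, is homeomorphic to ℝ⁵. -/

import Mathlib

/-- `⊤_c`, as a function of `(t012, e01, e10, e12, e21)`. -/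
def topC (t012 e01 e10 e12 e21 : ℝ) : ℝ :=
  e01 * e10 ^ 2 * e12 ^ 2 * e21 * t012 - e12 ^ 3 - 1

/-- `⊥_c`, as a function of `(t012, e01, e10, e12, e21)`. -/
def botC (t012 e01 e10 e12 e21 : ℝ) : ℝ :=
  e21 ^ 3 * t012 + t012 - e01 ^ 2 * e10 * e12 * e21 ^ 2

/-- `p = (e12³+1)/(e01·e10²·e12²·e21)`. -/
noncomputable def pC (e01 e10 e12 e21 : ℝ) : ℝ :=
  (e12 ^ 3 + 1) / (e01 * e10 ^ 2 * e12 ^ 2 * e21)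

/-- `q = (e01²·e10·e12·e21²)/(e21³+1)`. -/
noncomputable def qC (e01 e10 e12 e21 : ℝ) : ℝ :=
  (e01 ^ 2 * e10 * e12 * e21 ^ 2) / (e21 ^ 3 + 1)

/-- The last piece: `⊤_c < 0` and `⊥_c < 0` inside `(0,∞)⁵`, coordinates
`(t012, e01, e10, e12, e21)`. -/
def cyanNegPiece : Set (Fin 5 → ℝ) :=
  {x | (∀ i, 0 < x i) ∧
    topC (x 0) (x 1) (x 2) (x 3) (x 4) < 0 ∧
    botC (x 0) (x 1) (x 2) (x 3) (x 4) < 0}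

/-- The part of the open positive orthant lying strictly below the graph of a continuous positive
function of the last `n` coordinates is homeomorphic to `ℝⁿ⁺¹`. -/
noncomputable def homeomorphPosSubgraph {n : ℕ} (f : (Fin n → ℝ) → ℝ)
    (hpos : ∀ x, (∀ i, 0 < x i) → 0 < f x) (hf : ContinuousOn f {x | ∀ i, 0 < x i}) :
    {x : Fin (n + 1) → ℝ | (∀ i, 0 < x i) ∧ x 0 < f (Fin.tail x)} ≃ₜ (Fin (n + 1) → ℝ) where
  toFun x := Fin.cons (Real.log (x.1 0 / (f (Fin.tail x.1) - x.1 0)))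
    fun i => Real.log (x.1 i.succ)
  invFun y := ⟨Fin.cons (f (fun i => Real.exp (y i.succ)) * (Real.exp (y 0) / (1 + Real.exp (y 0))))
      fun i => Real.exp (y i.succ), by
    have h := hpos (fun i => Real.exp (y i.succ)) fun i => Real.exp_pos _
    refine ⟨fun i => ?_, ?_⟩
    · refine Fin.cases ?_ (fun j => ?_) i
      · simp only [Fin.cons_zero]; positivity
      · simp only [Fin.cons_succ]; positivity
    · simp only [Fin.cons_zero, Fin.tail_cons]
      refine mul_lt_of_lt_one_right h ?_
      rw [div_lt_one (by positivity)]
      linarith⟩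
  left_inv := by
    rintro ⟨x, hx, hlt⟩
    have h0 := hx 0
    have hsub : 0 < f (Fin.tail x) - x 0 := sub_pos.2 hlt
    have htail : (fun i : Fin n => Real.exp (Real.log (x i.succ))) = Fin.tail x :=
      funext fun i => Real.exp_log (hx i.succ)
    ext i
    refine Fin.cases ?_ (fun j => ?_) i
    · simp only [Fin.cons_zero, Fin.cons_succ, htail]
      rw [Real.exp_log (div_pos h0 hsub)]
      field_simp
      ring
    · simp only [Fin.cons_succ]
      exact Real.exp_log (hx j.succ)
  right_inv := by
    intro y
    have h := hpos (fun i => Real.exp (y i.succ)) fun i => Real.exp_pos _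
    funext i
    refine Fin.cases ?_ (fun j => ?_) i
    · simp only [Fin.cons_zero, Fin.tail_cons]
      set a := f fun i => Real.exp (y i.succ)
      have hE := Real.exp_pos (y 0)
      have key : a * (Real.exp (y 0) / (1 + Real.exp (y 0))) /
          (a - a * (Real.exp (y 0) / (1 + Real.exp (y 0)))) = Real.exp (y 0) := by
        have hsub : a - a * (Real.exp (y 0) / (1 + Real.exp (y 0))) =
            a / (1 + Real.exp (y 0)) := by
          field_simp
          ring
        rw [hsub]
        field_simp
      rw [key, Real.log_exp]
    · simp only [Fin.cons_succ, Real.log_exp]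
  continuous_toFun := by
    have htail : Continuous fun x : {x : Fin (n + 1) → ℝ |
        (∀ i, 0 < x i) ∧ x 0 < f (Fin.tail x)} => f (Fin.tail x.1) :=
      hf.comp_continuous (continuous_pi fun i => (continuous_apply i.succ).comp continuous_subtype_val)
        fun x i => x.2.1 i.succ
    have h0 : Continuous fun x : {x : Fin (n + 1) → ℝ |
        (∀ i, 0 < x i) ∧ x 0 < f (Fin.tail x)} => x.1 0 :=
      (continuous_apply 0).comp continuous_subtype_val
    refine continuous_pi fun i => ?_
    refine Fin.cases ?_ (fun j => ?_) i
    · simp only [Fin.cons_zero]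
      have hsub x : x ∈ {x : Fin (n + 1) → ℝ | (∀ i, 0 < x i) ∧ x 0 < f (Fin.tail x)} →
          0 < f (Fin.tail x) - x 0 := fun hx => sub_pos.2 hx.2
      exact (h0.div (htail.sub h0) fun x => (hsub x.1 x.2).ne').log
        fun x => (div_pos (x.2.1 0) (hsub x.1 x.2)).ne'
    · simp only [Fin.cons_succ]
      exact ((continuous_apply j.succ).comp continuous_subtype_val).log fun x => (x.2.1 j.succ).ne'
  continuous_invFun := by
    have hcomp : Continuous fun y : Fin (n + 1) → ℝ => f fun i => Real.exp (y i.succ) :=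
      hf.comp_continuous (by fun_prop) fun y i => Real.exp_pos _
    refine Continuous.subtype_mk (continuous_pi fun i => ?_) _
    refine Fin.cases ?_ (fun j => ?_) i
    · simp only [Fin.cons_zero]
      exact hcomp.mul (Continuous.div (by fun_prop) (by fun_prop) fun y => by positivity)
    · simp only [Fin.cons_succ]
      fun_prop

theorem topC_neg_iff {t a b c d : ℝ} (ha : 0 < a) (hb : 0 < b) (hc : 0 < c) (hd : 0 < d) :
    topC t a b c d < 0 ↔ t < pC a b c d := by
  rw [topC, pC, lt_div_iff₀ (by positivity)]
  constructor <;> intro h <;> linarith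

theorem botC_neg_iff {t a b c d : ℝ} (hd : 0 < d) :
    botC t a b c d < 0 ↔ t < qC a b c d := by
  rw [botC, qC, lt_div_iff₀ (by positivity)]
  constructor <;> intro h <;> linarith

theorem cyanNegPiece_eq :
    cyanNegPiece =
      {x : Fin 5 → ℝ | (∀ i, 0 < x i) ∧
        x 0 < min (pC (x 1) (x 2) (x 3) (x 4)) (qC (x 1) (x 2) (x 3) (x 4))} := by
  ext x
  refine and_congr_right fun hx => ?_
  rw [topC_neg_iff (hx 1) (hx 2) (hx 3) (hx 4), botC_neg_iff (hx 4), lt_min_iff]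

theorem stmt_7 :
    cyanNegPiece =
      {x : Fin 5 → ℝ | (∀ i, 0 < x i) ∧
        x 0 < min (pC (x 1) (x 2) (x 3) (x 4)) (qC (x 1) (x 2) (x 3) (x 4))} ∧
    Nonempty (↥cyanNegPiece ≃ₜ (Fin 5 → ℝ)) := by
  refine ⟨cyanNegPiece_eq, ?_⟩
  rw [cyanNegPiece_eq]
  refine ⟨homeomorphPosSubgraph (n := 4)
    (fun x => min (pC (x 0) (x 1) (x 2) (x 3)) (qC (x 0) (x 1) (x 2) (x 3))) ?_ ?_⟩
  · intro x hx
    have h0 := hx 0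
    have h1 := hx 1
    have h2 := hx 2
    have h3 := hx 3
    rw [lt_min_iff, pC, qC]
    constructor <;> positivity
  · unfold pC qC
    refine ContinuousOn.inf (ContinuousOn.div (by fun_prop) (by fun_prop) ?_)
      (ContinuousOn.div (by fun_prop) (by fun_prop) ?_) <;>
    · intro x hx
      have h0 := hx 0
      have h1 := hx 1
      have h2 := hx 2
      have h3 := hx 3
      positivity
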